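/- arXiv:2504.16469 — 4 statements merged into one kernel-verified Lean document; each statement's English description precedes it below -/
import Mathlib

section
/- Let Y be a real-valued random variable on a probability space whose distribution has no atom at 0 (P(Y = 0) = 0), and let s > 0 be a real number such that E[e^{−sY}] < ∞. Define the bilateral Laplace transform B(z) = E[e^{−zY}] for complex z with real part equal to 0 or to s. Assume that for every ε > 0 the function u ↦ (B(s − iu) − B(−iu))/u is Lebesgue integrable on {u ∈ ℝ : |u| ≥ ε} and that the Cauchy principal-value limit lim_{ε→0⁺} ∫_{|u|≥ε} (B(s − iu) − B(−iu)) du/u exists. Then E[e^{−s·max(Y,0)}] = (1/(2πi)) · lim_{ε→0⁺} ∫_{|u|≥ε} (B(s − iu) − B(−iu)) du/u + (1/2)(1 + B(s)). -/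
open MeasureTheory Filter

theorem integral_sin_mul_exp_neg (t T : ℝ) :
    ∫ x in (0 : ℝ)..T, Real.sin x * Real.exp (-t * x)
      = (1 + t ^ 2)⁻¹ - Real.exp (-t * T) * (Real.cos T + t * Real.sin T) * (1 + t ^ 2)⁻¹ := by
  have hpos : (1 + t ^ 2) ≠ 0 := by positivity
  have hderiv (x : ℝ) : HasDerivAt
      (fun x => -(Real.exp (-t * x) * (Real.cos x + t * Real.sin x)) * (1 + t ^ 2)⁻¹)
      (Real.sin x * Real.exp (-t * x)) x := by
    have h1 : HasDerivAt (fun x => Real.exp (-t * x)) (Real.exp (-t * x) * (-t)) x := by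
      simpa using ((hasDerivAt_id x).const_mul (-t)).exp
    have h2 : HasDerivAt (fun x => Real.cos x + t * Real.sin x)
        (-Real.sin x + t * Real.cos x) x :=
      (Real.hasDerivAt_cos x).add ((Real.hasDerivAt_sin x).const_mul t)
    refine ((h1.mul h2).neg.mul_const _).congr_deriv ?_
    field_simp
    ring
  rw [intervalIntegral.integral_eq_sub_of_hasDerivAt (fun x _ => hderiv x)
    (Continuous.intervalIntegrable (by fun_prop) _ _)]
  simp
  ring

theorem integrable_sin_mul_exp_neg_prod (T : ℝ) :
    Integrable (Function.uncurry fun x t : ℝ => Real.sin x * Real.exp (-t * x))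
      ((volume.restrict (Set.Ioc 0 T)).prod (volume.restrict (Set.Ioi 0))) := by
  rw [integrable_prod_iff (Continuous.aestronglyMeasurable (by fun_prop))]
  constructor
  · filter_upwards [ae_restrict_mem measurableSet_Ioc] with x hx
    simpa [mul_comm] using (exp_neg_integrableOn_Ioi 0 hx.1).const_mul (Real.sin x)
  · have hsinc : IntegrableOn (fun x => |Real.sinc x|) (Set.Ioc 0 T) :=
      (Real.continuous_sinc.abs.integrableOn_Icc).mono_set Set.Ioc_subset_Icc_self
    refine hsinc.congr ?_
    filter_upwards [ae_restrict_mem measurableSet_Ioc] with x hx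
    have h := integral_exp_mul_Ioi (neg_lt_zero.2 hx.1) 0
    have h2 (t : ℝ) : ‖Function.uncurry (fun x t : ℝ => Real.sin x * Real.exp (-t * x)) (x, t)‖
        = |Real.sin x| * Real.exp (-x * t) := by
      simp [mul_comm]
    simp_rw [h2]
    rw [integral_const_mul, h, Real.sinc_of_ne_zero hx.1.ne', abs_div, abs_of_pos hx.1]
    simp [div_eq_mul_inv]

theorem abs_integral_sinc_sub_pi_div_two_le {T : ℝ} (hT : 0 < T) :
    |(∫ x in (0 : ℝ)..T, Real.sinc x) - Real.pi / 2| ≤ 2 / T := by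
  have hexp : IntegrableOn (fun t => Real.exp (-T * t)) (Set.Ioi 0) :=
    exp_neg_integrableOn_Ioi 0 hT
  have hbound : ∀ t ∈ Set.Ioi (0 : ℝ),
      ‖Real.exp (-t * T) * (Real.cos T + t * Real.sin T) * (1 + t ^ 2)⁻¹‖
        ≤ 2 * Real.exp (-T * t) := by
    intro t (ht : 0 < t)
    have h1 : |Real.cos T + t * Real.sin T| ≤ 1 + t := by
      refine (abs_add_le _ _).trans ?_
      rw [abs_mul, abs_of_pos ht]
      nlinarith [Real.abs_cos_le_one T, Real.abs_sin_le_one T]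
    have h2 : |Real.cos T + t * Real.sin T| * (1 + t ^ 2)⁻¹ ≤ 2 := by
      rw [← div_eq_mul_inv, div_le_iff₀ (by positivity)]
      nlinarith [sq_nonneg (t - 1), sq_nonneg t]
    rw [norm_mul, norm_mul, Real.norm_eq_abs, Real.norm_eq_abs, Real.norm_eq_abs, Real.abs_exp,
      abs_of_pos (a := (1 + t ^ 2)⁻¹) (by positivity), mul_assoc,
      show -t * T = -T * t by ring]
    nlinarith [Real.exp_pos (-T * t)]
  have hrem : IntegrableOn
      (fun t => Real.exp (-t * T) * (Real.cos T + t * Real.sin T) * (1 + t ^ 2)⁻¹) (Set.Ioi 0) :=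
    (hexp.const_mul 2).mono' (Measurable.aestronglyMeasurable (by fun_prop))
      ((ae_restrict_iff' measurableSet_Ioi).2 (Eventually.of_forall hbound))
  have hmain : ∫ x in (0 : ℝ)..T, Real.sinc x = Real.pi / 2
      - ∫ t in Set.Ioi 0,
          Real.exp (-t * T) * (Real.cos T + t * Real.sin T) * (1 + t ^ 2)⁻¹ := by
    calc ∫ x in (0 : ℝ)..T, Real.sinc x
        = ∫ x in Set.Ioc 0 T, ∫ t in Set.Ioi 0, Real.sin x * Real.exp (-t * x) := by
          rw [intervalIntegral.integral_of_le hT.le]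
          refine setIntegral_congr_fun measurableSet_Ioc fun x hx => ?_
          have h := integral_exp_mul_Ioi (neg_lt_zero.2 hx.1) 0
          simp only [integral_const_mul, Real.sinc_of_ne_zero hx.1.ne']
          simp_rw [show ∀ t, -t * x = -x * t from fun t => by ring]
          rw [h]
          simp [div_eq_mul_inv]
      _ = ∫ t in Set.Ioi 0, ∫ x in Set.Ioc 0 T, Real.sin x * Real.exp (-t * x) :=
          integral_integral_swap (integrable_sin_mul_exp_neg_prod T)
      _ = ∫ t in Set.Ioi 0, ((1 + t ^ 2)⁻¹
            - Real.exp (-t * T) * (Real.cos T + t * Real.sin T) * (1 + t ^ 2)⁻¹) := by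
          simp_rw [← intervalIntegral.integral_of_le hT.le, integral_sin_mul_exp_neg]
      _ = _ := by
          rw [integral_sub integrable_inv_one_add_sq.integrableOn hrem,
            integral_Ioi_inv_one_add_sq]
          simp
  rw [hmain, sub_sub_cancel_left, abs_neg, ← Real.norm_eq_abs]
  refine (norm_integral_le_of_norm_le (hexp.const_mul 2)
    ((ae_restrict_iff' measurableSet_Ioi).2 (Eventually.of_forall hbound))).trans_eq ?_
  rw [integral_const_mul, integral_exp_mul_Ioi (neg_lt_zero.2 hT)]
  simp [div_eq_mul_inv]

theorem integral_sinc_neg (T : ℝ) :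
    ∫ x in (0 : ℝ)..(-T), Real.sinc x = -∫ x in (0 : ℝ)..T, Real.sinc x := by
  have h := intervalIntegral.integral_comp_neg (a := 0) (b := T) Real.sinc
  simp only [Real.sinc_neg, neg_zero] at h
  rw [h, intervalIntegral.integral_symm]

theorem tendsto_integral_sinc_atTop :
    Tendsto (fun T : ℝ => ∫ x in (0 : ℝ)..T, Real.sinc x) atTop (nhds (Real.pi / 2)) := by
  rw [tendsto_iff_norm_sub_tendsto_zero]
  refine squeeze_zero' (Eventually.of_forall fun _ => norm_nonneg _) ?_
    (tendsto_const_nhds.div_atTop tendsto_id : Tendsto (fun T : ℝ => 2 / T) atTop (nhds 0))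
  filter_upwards [eventually_gt_atTop 0] with T hT
  exact abs_integral_sinc_sub_pi_div_two_le hT

theorem abs_integral_sinc_le (T : ℝ) : |∫ x in (0 : ℝ)..T, Real.sinc x| ≤ 4 := by
  wlog hT : 0 ≤ T generalizing T
  · have h := this (-T) (by linarith)
    rwa [integral_sinc_neg, abs_neg] at h
  rcases le_total T 1 with h | h
  · have h1 := intervalIntegral.norm_integral_le_of_norm_le_const (a := 0) (b := T)
      (f := Real.sinc) (C := 1) fun x _ => Real.abs_sinc_le_one x
    rw [Real.norm_eq_abs, sub_zero, abs_of_nonneg hT] at h1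
    linarith
  · have h1 := abs_integral_sinc_sub_pi_div_two_le (lt_of_lt_of_le one_pos h)
    have h2 : 2 / T ≤ 2 := div_le_self (by norm_num) h
    have h3 := abs_le.1 (h1.trans h2)
    rw [abs_le]
    constructor <;> linarith [Real.pi_pos, Real.pi_lt_four, h3.1, h3.2]

theorem continuous_integral_sinc : Continuous fun T : ℝ => ∫ x in (0 : ℝ)..T, Real.sinc x :=
  intervalIntegral.continuous_primitive
    (fun _ _ => Real.continuous_sinc.intervalIntegrable _ _) 0

theorem tendsto_integral_sinc_mul_atTop (y : ℝ) :
    Tendsto (fun R : ℝ => ∫ x in (0 : ℝ)..(R * y), Real.sinc x) atTop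
      (nhds (Real.pi / 2 * Real.sign y)) := by
  rcases lt_trichotomy y 0 with hy | rfl | hy
  · have h := (tendsto_integral_sinc_atTop.comp
      (tendsto_id.atTop_mul_const (neg_pos.2 hy))).neg
    rw [Real.sign_of_neg hy]
    simpa [Function.comp_def, integral_sinc_neg] using h
  · simp
  · rw [Real.sign_of_pos hy]
    simpa [Function.comp_def] using
      tendsto_integral_sinc_atTop.comp (tendsto_id.atTop_mul_const hy)

theorem integral_sin_mul_div {ε R : ℝ} (hε : 0 < ε) (hR : ε ≤ R) (y : ℝ) :
    ∫ u in ε..R, Real.sin (u * y) / u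
      = (∫ x in (0 : ℝ)..(R * y), Real.sinc x) - ∫ x in (0 : ℝ)..(ε * y), Real.sinc x := by
  have hi (a b : ℝ) : IntervalIntegrable Real.sinc volume a b :=
    Real.continuous_sinc.intervalIntegrable _ _
  rw [intervalIntegral.integral_interval_sub_left (hi _ _) (hi _ _),
    ← intervalIntegral.smul_integral_comp_mul_right, ← intervalIntegral.integral_smul]
  refine intervalIntegral.integral_congr fun u hu => ?_
  rw [Set.uIcc_of_le hR] at hu
  have hu0 : u ≠ 0 := (hε.trans_le hu.1).ne'
  by_cases hy : y = 0
  · simp [hy]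
  · simp only [smul_eq_mul]
    rw [Real.sinc_of_ne_zero (mul_ne_zero hu0 hy)]
    field_simp

/-- The integral of `f u` over `{ε ≤ |u|}` folds onto the positive half line. -/
theorem setIntegral_le_abs_eq {f : ℝ → ℂ} {ε : ℝ} (hε : 0 < ε)
    (hf : IntegrableOn f {u : ℝ | ε ≤ |u|}) :
    IntegrableOn (fun u => f u + f (-u)) (Set.Ioi ε) ∧
      ∫ u in {u : ℝ | ε ≤ |u|}, f u = ∫ u in Set.Ioi ε, (f u + f (-u)) := by
  have hset : {u : ℝ | ε ≤ |u|} = Set.Ici ε ∪ Set.Iic (-ε) := by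
    ext u
    simp [le_abs, le_neg]
  rw [hset] at hf ⊢
  have h1 : IntegrableOn f (Set.Ioi ε) :=
    (hf.mono_set Set.subset_union_left).mono_set Set.Ioi_subset_Ici_self
  have h2 : IntegrableOn (fun u => f (-u)) (Set.Ioi ε) :=
    (IntegrableOn.comp_neg_Ici (hf.mono_set Set.subset_union_right)).mono_set
      Set.Ioi_subset_Ici_self
  refine ⟨h1.add h2, ?_⟩
  have hdisj : Disjoint (Set.Ici ε) (Set.Iic (-ε)) := by
    rw [Set.disjoint_left]
    intro u (hu : ε ≤ u) (hu' : u ≤ -ε)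
    linarith
  rw [setIntegral_union hdisj measurableSet_Iic (hf.mono_set Set.subset_union_left)
    (hf.mono_set Set.subset_union_right), integral_add h1 h2, integral_Ici_eq_integral_Ioi,
    integral_comp_neg_Ioi]

theorem norm_mul_integral_sinc_sub_le (a b c : ℝ) :
    ‖a * ((∫ x in (0 : ℝ)..b, Real.sinc x) - ∫ x in (0 : ℝ)..c, Real.sinc x)‖ ≤ ‖a‖ * 8 := by
  rw [norm_mul, Real.norm_eq_abs (_ - _)]
  gcongr
  linarith [abs_sub (∫ x in (0 : ℝ)..b, Real.sinc x) (∫ x in (0 : ℝ)..c, Real.sinc x),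
    abs_integral_sinc_le b, abs_integral_sinc_le c]

section

variable {Ω : Type*} [MeasurableSpace Ω] {P : Measure Ω} {Y w : Ω → ℝ}

theorem integral_integral_sin_mul_div [SFinite P] (hY : Measurable Y) (hw : Integrable w P) {ε R : ℝ}
    (hε : 0 < ε) (hR : ε ≤ R) :
    ∫ u in ε..R, ∫ ω, w ω * (Real.sin (u * Y ω) / u) ∂P
      = ∫ ω, w ω * ((∫ x in (0 : ℝ)..(R * Y ω), Real.sinc x)
          - ∫ x in (0 : ℝ)..(ε * Y ω), Real.sinc x) ∂P := by
  have hint : Integrable (Function.uncurry fun (u : ℝ) ω => w ω * (Real.sin (u * Y ω) / u))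
      ((volume.restrict (Set.Ioc ε R)).prod P) := by
    have hw' : Integrable (fun z : ℝ × Ω => w z.2) ((volume.restrict (Set.Ioc ε R)).prod P) :=
      hw.comp_snd _
    have hb : Integrable (fun z : ℝ × Ω => (Real.sin (z.1 * Y z.2) / z.1) * w z.2)
        ((volume.restrict (Set.Ioc ε R)).prod P) := by
      refine hw'.bdd_mul (c := ε⁻¹) (Measurable.aestronglyMeasurable (by fun_prop)) ?_
      have hmem : ∀ᵐ z : ℝ × Ω ∂((volume.restrict (Set.Ioc ε R)).prod P), z.1 ∈ Set.Ioc ε R :=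
        Measure.quasiMeasurePreserving_fst.ae (ae_restrict_mem measurableSet_Ioc)
      filter_upwards [hmem] with z hz
      rw [Real.norm_eq_abs, abs_div, abs_of_pos (hε.trans hz.1), div_eq_mul_inv]
      exact (mul_le_mul (Real.abs_sin_le_one _) (inv_anti₀ hε hz.1.le)
        (inv_nonneg.2 (hε.trans hz.1).le) zero_le_one).trans_eq (one_mul _)
    exact hb.congr (Eventually.of_forall fun z => mul_comm _ _)
  rw [intervalIntegral.integral_of_le hR, integral_integral_swap hint]
  simp_rw [integral_const_mul, ← intervalIntegral.integral_of_le hR,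
    integral_sin_mul_div hε hR]

theorem tendsto_integral_mul_sinc_sub_atTop (hY : Measurable Y) (hw : Integrable w P) (ε : ℝ) :
    Tendsto (fun R : ℝ => ∫ ω, w ω * ((∫ x in (0 : ℝ)..(R * Y ω), Real.sinc x)
          - ∫ x in (0 : ℝ)..(ε * Y ω), Real.sinc x) ∂P) atTop
      (nhds (∫ ω, w ω * (Real.pi / 2 * Real.sign (Y ω)
          - ∫ x in (0 : ℝ)..(ε * Y ω), Real.sinc x) ∂P)) := by
  have hS := continuous_integral_sinc.measurable
  refine tendsto_integral_filter_of_dominated_convergence (fun ω => ‖w ω‖ * 8)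
    (Eventually.of_forall fun R => ?_)
    (Eventually.of_forall fun R => Eventually.of_forall fun ω =>
      norm_mul_integral_sinc_sub_le _ _ _)
    (hw.norm.mul_const 8) (Eventually.of_forall fun ω =>
      ((tendsto_integral_sinc_mul_atTop (Y ω)).sub_const _).const_mul _)
  exact hw.aestronglyMeasurable.mul
    ((hS.comp (hY.const_mul R)).sub (hS.comp (hY.const_mul ε))).aestronglyMeasurable

theorem tendsto_integral_mul_sign_sub_sinc_zero (hY : Measurable Y) (hw : Integrable w P) :
    Tendsto (fun ε : ℝ => ∫ ω, w ω * (Real.pi / 2 * Real.sign (Y ω)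
          - ∫ x in (0 : ℝ)..(ε * Y ω), Real.sinc x) ∂P) (nhdsWithin 0 (Set.Ioi 0))
      (nhds (∫ ω, w ω * (Real.pi / 2 * Real.sign (Y ω)) ∂P)) := by
  have hS := continuous_integral_sinc.measurable
  have hsign : Measurable fun ω => Real.pi / 2 * Real.sign (Y ω) :=
    (Measurable.ite measurableSet_Iio measurable_const
      (Measurable.ite measurableSet_Ioi measurable_const measurable_const)).comp hY
      |>.const_mul _
  refine tendsto_integral_filter_of_dominated_convergence (fun ω => ‖w ω‖ * 8)
    (Eventually.of_forall fun ε => ?_)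
    (Eventually.of_forall fun ε => Eventually.of_forall fun ω => ?_)
    (hw.norm.mul_const 8) (Eventually.of_forall fun ω => ?_)
  · exact hw.aestronglyMeasurable.mul
      (hsign.sub (hS.comp (hY.const_mul ε))).aestronglyMeasurable
  · refine le_of_tendsto
      ((((tendsto_integral_sinc_mul_atTop (Y ω)).sub_const _).const_mul (w ω)).norm)
      (Eventually.of_forall fun R => norm_mul_integral_sinc_sub_le _ _ _)
  · have h : Tendsto (fun ε : ℝ => w ω * (Real.pi / 2 * Real.sign (Y ω)
        - ∫ x in (0 : ℝ)..(ε * Y ω), Real.sinc x)) (nhds 0)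
        (nhds (w ω * (Real.pi / 2 * Real.sign (Y ω) - ∫ x in (0 : ℝ)..(0 * Y ω), Real.sinc x))) :=
      ((tendsto_const_nhds.sub
        ((continuous_integral_sinc.comp (continuous_id.mul continuous_const)).tendsto 0))).const_mul
          _
    simpa using h.mono_left nhdsWithin_le_nhds

/-- The odd part of a Fourier integral with real weight `w` is a sine integral. -/
theorem integral_mul_exp_div_add_neg (hY : Measurable Y) (hw : Integrable w P) (u : ℝ) :
    (∫ ω, (w ω : ℂ) * Complex.exp ((u * Y ω : ℝ) * Complex.I) ∂P) / (u : ℂ)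
      + (∫ ω, (w ω : ℂ) * Complex.exp (((-u) * Y ω : ℝ) * Complex.I) ∂P) / ((-u : ℝ) : ℂ)
      = 2 * Complex.I * ((∫ ω, w ω * (Real.sin (u * Y ω) / u) ∂P : ℝ) : ℂ) := by
  have hi (v : ℝ) :
      Integrable (fun ω => (w ω : ℂ) * Complex.exp ((v * Y ω : ℝ) * Complex.I)) P := by
    refine (hw.ofReal.bdd_mul (c := 1) (f := fun ω => Complex.exp ((v * Y ω : ℝ) * Complex.I))
      (Measurable.aestronglyMeasurable (by fun_prop))
      (Eventually.of_forall fun ω => (Complex.norm_exp_ofReal_mul_I _).le)).congr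
      (Eventually.of_forall fun ω => mul_comm _ _)
  rw [← integral_div, ← integral_div, ← integral_add ((hi u).div_const _) ((hi (-u)).div_const _),
    ← integral_complex_ofReal, ← integral_const_mul]
  congr 1
  ext ω
  push_cast
  rw [neg_mul, neg_mul, Complex.exp_mul_I, show -((u : ℂ) * (Y ω : ℂ) * Complex.I)
    = (-((u : ℂ) * (Y ω : ℂ))) * Complex.I by ring, Complex.exp_mul_I, Complex.cos_neg,
    Complex.sin_neg, div_neg]
  ring

end

/-- Theorem 1: the (unilateral) Laplace transform of the positive part of a real random
variable `Y` in terms of its bilateral Laplace transform `B(z) = E[e^{−zY}]`: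
`E[e^{−s·max(Y,0)}] = (1/(2πi)) · p.v.∫ (B(s−iu) − B(−iu)) du/u + (1/2)(1 + B(s))`,
the principal value being the limit as `ε → 0⁺` of the integral over `{|u| ≥ ε}`. -/
theorem laplace_transform_positive_part
    {Ω : Type*} [MeasurableSpace Ω] (P : Measure Ω) [IsProbabilityMeasure P]
    (Y : Ω → ℝ) (hY : Measurable Y)
    (hatom : P {ω | Y ω = 0} = 0)
    (s : ℝ) (hs : 0 < s)
    (hint : Integrable (fun ω => Real.exp (-(s * Y ω))) P)
    (B : ℂ → ℂ)
    (hB : ∀ z : ℂ, z.re = 0 ∨ z.re = s →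
      B z = ∫ ω, Complex.exp (-(z * (Y ω : ℂ))) ∂P)
    (hInt : ∀ ε : ℝ, 0 < ε →
      IntegrableOn
        (fun u : ℝ => (B ((s : ℂ) - Complex.I * (u : ℂ)) - B (-(Complex.I * (u : ℂ)))) / (u : ℂ))
        {u : ℝ | ε ≤ |u|})
    (L : ℂ)
    (hL : Tendsto
      (fun ε : ℝ => ∫ u in {u : ℝ | ε ≤ |u|},
        (B ((s : ℂ) - Complex.I * (u : ℂ)) - B (-(Complex.I * (u : ℂ)))) / (u : ℂ))
      (nhdsWithin 0 (Set.Ioi 0)) (nhds L)) :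
    ((∫ ω, Real.exp (-(s * max (Y ω) 0)) ∂P : ℝ) : ℂ)
      = (1 / (2 * (Real.pi : ℂ) * Complex.I)) * L + (1 / 2) * (1 + B (s : ℂ)) := by
  have hw : Integrable (fun ω => Real.exp (-(s * Y ω)) - 1) P := hint.sub (integrable_const _)
  have hnorm (z : ℂ) (hz : z.re = 0 ∨ z.re = s) :
      Integrable (fun ω => Complex.exp (-(z * (Y ω : ℂ)))) P := by
    have hm : AEStronglyMeasurable (fun ω => Complex.exp (-(z * (Y ω : ℂ)))) P :=
      Measurable.aestronglyMeasurable (by fun_prop)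
    rcases hz with hz | hz
    · refine (integrable_const (1 : ℝ)).mono' hm (Eventually.of_forall fun ω => ?_)
      simp [Complex.norm_exp, hz]
    · refine hint.mono' hm (Eventually.of_forall fun ω => ?_)
      simp [Complex.norm_exp, hz]
  have hdiff (u : ℝ) : B ((s : ℂ) - Complex.I * (u : ℂ)) - B (-(Complex.I * (u : ℂ)))
      = ∫ ω, ((Real.exp (-(s * Y ω)) - 1 : ℝ) : ℂ)
          * Complex.exp ((u * Y ω : ℝ) * Complex.I) ∂P := by
    have h1 : ((s : ℂ) - Complex.I * (u : ℂ)).re = 0 ∨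
        ((s : ℂ) - Complex.I * (u : ℂ)).re = s := by simp
    have h2 : (-(Complex.I * (u : ℂ))).re = 0 ∨ (-(Complex.I * (u : ℂ))).re = s := by simp
    rw [hB _ h1, hB _ h2, ← integral_sub (hnorm _ h1) (hnorm _ h2)]
    congr 1
    ext ω
    push_cast
    rw [sub_mul (Complex.exp _) 1, ← Complex.exp_add, one_mul]
    congr 2 <;> ring
  have hfold (ε : ℝ) (hε : 0 < ε) :
      ∫ u in {u : ℝ | ε ≤ |u|},
        (B ((s : ℂ) - Complex.I * (u : ℂ)) - B (-(Complex.I * (u : ℂ)))) / (u : ℂ)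
      = 2 * Complex.I * ((∫ ω, (Real.exp (-(s * Y ω)) - 1) * (Real.pi / 2 * Real.sign (Y ω)
          - ∫ x in (0 : ℝ)..(ε * Y ω), Real.sinc x) ∂P : ℝ) : ℂ) := by
    obtain ⟨hG, hGeq⟩ := setIntegral_le_abs_eq hε (hInt ε hε)
    rw [hGeq]
    refine tendsto_nhds_unique (intervalIntegral_tendsto_integral_Ioi ε hG tendsto_id) ?_
    refine (((Complex.continuous_ofReal.tendsto _).comp
      (tendsto_integral_mul_sinc_sub_atTop hY hw ε)).const_mul (2 * Complex.I)).congr' ?_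
    filter_upwards [eventually_ge_atTop ε] with R hR
    simp only [hdiff, integral_mul_exp_div_add_neg hY hw, Function.comp_apply, id,
      intervalIntegral.integral_const_mul, intervalIntegral.integral_ofReal,
      integral_integral_sin_mul_div hY hw hε hR]
  have hL' : L = 2 * Complex.I *
      ((∫ ω, (Real.exp (-(s * Y ω)) - 1) * (Real.pi / 2 * Real.sign (Y ω)) ∂P : ℝ) : ℂ) := by
    refine tendsto_nhds_unique hL ((((Complex.continuous_ofReal.tendsto _).comp
      (tendsto_integral_mul_sign_sub_sinc_zero hY hw)).const_mul (2 * Complex.I)).congr' ?_)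
    filter_upwards [self_mem_nhdsWithin] with ε hε
    exact (hfold ε hε).symm
  have hBs : B (s : ℂ) = ((∫ ω, Real.exp (-(s * Y ω)) ∂P : ℝ) : ℂ) := by
    rw [hB _ (by simp), ← integral_complex_ofReal]
    push_cast
    rfl
  have hpoint (ω : Ω) : (Real.exp (-(s * Y ω)) - 1) * (Real.pi / 2 * Real.sign (Y ω))
      = Real.pi * (Real.exp (-(s * max (Y ω) 0)) - 1 / 2 * (1 + Real.exp (-(s * Y ω)))) := by
    rcases lt_trichotomy (Y ω) 0 with h | h | h
    · rw [Real.sign_of_neg h, max_eq_right h.le, mul_zero, neg_zero, Real.exp_zero]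
      ring
    · simp [h]
      norm_num
    · rw [Real.sign_of_pos h, max_eq_left h.le]
      ring
  have hmax : Integrable (fun ω => Real.exp (-(s * max (Y ω) 0))) P := by
    refine (integrable_const (1 : ℝ)).mono' (Measurable.aestronglyMeasurable (by fun_prop))
      (Eventually.of_forall fun ω => ?_)
    rw [Real.norm_eq_abs, Real.abs_exp, Real.exp_le_one_iff]
    exact neg_nonpos.2 (mul_nonneg hs.le (le_max_right _ _))
  have hval : ∫ ω, (Real.exp (-(s * Y ω)) - 1) * (Real.pi / 2 * Real.sign (Y ω)) ∂P
      = Real.pi * ((∫ ω, Real.exp (-(s * max (Y ω) 0)) ∂P)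
          - 1 / 2 * (1 + ∫ ω, Real.exp (-(s * Y ω)) ∂P)) := by
    have hsum : Integrable (fun ω => 1 + Real.exp (-(s * Y ω))) P := (integrable_const _).add hint
    simp_rw [hpoint]
    rw [integral_const_mul, integral_sub hmax (hsum.const_mul _),
      integral_const_mul, integral_add (integrable_const _) hint]
    simp
  rw [hL', hBs, hval]
  have hpi : (Real.pi : ℂ) ≠ 0 := Complex.ofReal_ne_zero.2 Real.pi_ne_zero
  push_cast
  field_simp
  ring
end

section
/- Let r, R, λ, β, M be strictly positive real numbers and α a real number. Set a = r/R and b = M²βr^α/R⁴, and assume b < (a − 1)² (in particular a ≠ 1). Set D(a,b) = a⁴ + (b − 1)² − 2a²(1 + b). Then exp( −λ R ∫₀^{2π} ( 1 − 1/(1 − b/((a + cos ψ)² + (sin ψ)²)) ) dψ ) = exp( 2π λ M² β r^α / ( R³ √(D(a,b)) ) ). -/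
open Real

theorem add_mul_cos_pos {A B : ℝ} (hAB : |B| < A) (x : ℝ) : 0 < A + B * cos x := by
  have h : |B * cos x| ≤ |B| := by
    rw [abs_mul]
    exact mul_le_of_le_one_right (abs_nonneg B) (abs_cos_le_one x)
  linarith [neg_abs_le (B * cos x)]

theorem hasDerivAt_sub_two_mul_arctan {A B s : ℝ} (hAB : |B| < A) (hs : 0 < s)
    (hsq : s ^ 2 = A ^ 2 - B ^ 2) (x : ℝ) :
    HasDerivAt (fun x => x - 2 * arctan (B * sin x / (A + s + B * cos x)))
      (s / (A + B * cos x)) x := by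
  have hpos := add_mul_cos_pos hAB x
  have hA : 0 < A := (abs_nonneg B).trans_lt hAB
  have hd : A + s + B * cos x ≠ 0 := by linarith
  have hquot : HasDerivAt (fun x => B * sin x / (A + s + B * cos x))
      ((B * cos x * (A + s + B * cos x) - B * sin x * (B * -sin x)) /
        (A + s + B * cos x) ^ 2) x :=
    ((hasDerivAt_sin x).const_mul B).div (((hasDerivAt_cos x).const_mul B).const_add (A + s)) hd
  refine ((hasDerivAt_id x).sub (hquot.arctan.const_mul 2)).congr_deriv ?_
  have hnum : B * cos x * (A + s + B * cos x) - B * sin x * (B * -sin x) =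
      (A + s) * (B * cos x + A - s) := by
    linear_combination B ^ 2 * sin_sq_add_cos_sq x + hsq
  have hden : (A + s + B * cos x) ^ 2 + (B * sin x) ^ 2 =
      2 * (A + s) * (A + B * cos x) := by
    linear_combination B ^ 2 * sin_sq_add_cos_sq x + hsq
  have hAs : A + s ≠ 0 := by positivity
  have hmul : 1 / (1 + (B * sin x / (A + s + B * cos x)) ^ 2) *
      ((A + s) * (B * cos x + A - s) / (A + s + B * cos x) ^ 2) =
      (A + s) * (B * cos x + A - s) /
        ((A + s + B * cos x) ^ 2 + (B * sin x) ^ 2) := by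
    have h₁ : (A + s + B * cos x) ^ 2 + (B * sin x) ^ 2 ≠ 0 := by positivity
    field_simp
  rw [hnum, hmul, hden]
  field_simp
  ring

theorem integral_one_div_add_mul_cos {A B : ℝ} (hAB : |B| < A) :
    ∫ x in (0 : ℝ)..(2 * π), 1 / (A + B * cos x) = 2 * π / √(A ^ 2 - B ^ 2) := by
  have hpos : 0 < A ^ 2 - B ^ 2 := by
    have := sq_lt_sq' (neg_lt_of_abs_lt hAB) (lt_of_abs_lt hAB)
    linarith
  have hs : 0 < √(A ^ 2 - B ^ 2) := sqrt_pos.2 hpos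
  have hne (x : ℝ) : A + B * cos x ≠ 0 := (add_mul_cos_pos hAB x).ne'
  have hcont : Continuous fun x => √(A ^ 2 - B ^ 2) / (A + B * cos x) :=
    continuous_const.div (by fun_prop) hne
  have hint := intervalIntegral.integral_eq_sub_of_hasDerivAt (a := 0) (b := 2 * π)
    (fun x _ => hasDerivAt_sub_two_mul_arctan hAB hs (sq_sqrt hpos.le) x)
    (hcont.intervalIntegrable _ _)
  simp only [div_eq_mul_one_div (√(A ^ 2 - B ^ 2)), intervalIntegral.integral_const_mul,
    sin_two_pi, sin_zero, mul_zero, zero_div, arctan_zero, sub_zero] at hint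
  rw [eq_div_iff hs.ne', mul_comm, hint]

/-- Closed form (Eq. (18)) for the Laplace transform of the aggregated reflected signal power
for PPP-distributed RISs on a circle of radius `R` with Rayleigh fading:
`exp(−λR ∫₀^{2π} (1 − 1/(1 − b/((a+cosψ)²+(sinψ)²))) dψ) = exp(2πλM²βr^α/(R³√D))`,
where `a = r/R`, `b = M²βr^α/R⁴`, `D = a⁴+(b−1)²−2a²(1+b)` and `b < (a−1)²`. -/
theorem ppp_rayleigh_laplace_closed_form
    (r R lam β M α : ℝ) (hr : 0 < r) (hR : 0 < R) (hlam : 0 < lam)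
    (hβ : 0 < β) (hM : 0 < M)
    (a b D : ℝ)
    (ha : a = r / R) (hb : b = M ^ 2 * β * r ^ α / R ^ 4)
    (hab : b < (a - 1) ^ 2)
    (hD : D = a ^ 4 + (b - 1) ^ 2 - 2 * a ^ 2 * (1 + b)) :
    Real.exp (-(lam * R *
        ∫ ψ in (0 : ℝ)..(2 * π),
          (1 - 1 / (1 - b / ((a + Real.cos ψ) ^ 2 + (Real.sin ψ) ^ 2)))))
      = Real.exp (2 * π * lam * M ^ 2 * β * r ^ α / (R ^ 3 * Real.sqrt D)) := by
  have hapos : 0 < a := ha ▸ div_pos hr hR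
  have hbpos : 0 < b := by
    rw [hb]
    positivity
  have hAB : |2 * a| < a ^ 2 + 1 - b := by
    rw [abs_of_pos (by positivity)]
    linarith
  have hpos (ψ : ℝ) : 0 < a ^ 2 + 1 - b + 2 * a * cos ψ := add_mul_cos_pos hAB ψ
  have hintegrand (ψ : ℝ) : 1 - 1 / (1 - b / ((a + cos ψ) ^ 2 + sin ψ ^ 2)) =
      -b * (1 / (a ^ 2 + 1 - b + 2 * a * cos ψ)) := by
    have hq : (a + cos ψ) ^ 2 + sin ψ ^ 2 = a ^ 2 + 1 - b + 2 * a * cos ψ + b := by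
      linear_combination sin_sq_add_cos_sq ψ
    have hp := hpos ψ
    rw [hq]
    generalize a ^ 2 + 1 - b + 2 * a * cos ψ = p at hp ⊢
    have hdiv : 1 - b / (p + b) = p / (p + b) := by
      field_simp
      ring
    rw [hdiv]
    field_simp
    ring
  have hDsq : (a ^ 2 + 1 - b) ^ 2 - (2 * a) ^ 2 = D := by
    rw [hD]
    ring
  have hcoef : R * b = M ^ 2 * β * r ^ α / R ^ 3 := by
    rw [hb]
    field_simp
  simp only [hintegrand, intervalIntegral.integral_const_mul,
    integral_one_div_add_mul_cos hAB, hDsq]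
  congr 1
  calc -(lam * R * (-b * (2 * π / √D))) = 2 * π * lam * (R * b) / √D := by ring
    _ = 2 * π * lam * M ^ 2 * β * r ^ α / (R ^ 3 * √D) := by
      rw [hcoef, ← div_div]
      ring
end

section
/- Let a ≥ 0 and b be real numbers with 0 < b < (a − 1)² (in particular a ≠ 1), and set D(a,b) = a⁴ + (b − 1)² − 2a²(1 + b). Then (1/(2π)) ∫₀^{2π} ( 1 + b / ((a + cos ψ)² + (sin ψ)² − b) )² dψ = 1 + ( 2b(1 − a²)² − 3b²(1 + a²) + b³ ) / D(a,b)^{3/2}. -/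
open Real

/-- The classical antiderivative of `1 / (P + Q cos x)`, written so that it is smooth on `ℝ`. -/
theorem hasDerivAt_integral_inv_add_mul_cos {P Q s : ℝ} (hs : 0 < s) (hP : |Q| < P)
    (hsq : s ^ 2 = P ^ 2 - Q ^ 2) (x : ℝ) :
    HasDerivAt (fun x => (x - 2 * arctan (Q * sin x / (P + s + Q * cos x))) / s)
      (1 / (P + Q * cos x)) x := by
  have hQ : |Q * cos x| ≤ |Q| := by
    rw [abs_mul]
    exact mul_le_of_le_one_right (abs_nonneg Q) (abs_cos_le_one x)
  have hX : 0 < P + Q * cos x := by linarith [neg_abs_le (Q * cos x)]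
  have hY : 0 < P + s + Q * cos x := by linarith
  have hP0 : 0 < P := (abs_nonneg Q).trans_lt hP
  have h := ((hasDerivAt_id x).sub ((((hasDerivAt_sin x).const_mul Q).div
    (((hasDerivAt_cos x).const_mul Q).const_add (P + s)) hY.ne').arctan.const_mul 2)).div_const s
  refine h.congr_deriv ?_
  have hden : 1 + (Q * sin x / (P + s + Q * cos x)) ^ 2
      = 2 * (P + s) * (P + Q * cos x) / (P + s + Q * cos x) ^ 2 := by
    field_simp
    linear_combination Q ^ 2 * sin_sq_add_cos_sq x + hsq
  have hPs : 0 < P + s := by linarith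
  simp only [Pi.div_apply]
  rw [hden]
  field_simp
  linear_combination (-Q ^ 2) * sin_sq_add_cos_sq x - hsq

/-- An antiderivative of `1 / (P + Q cos x) ^ 2` up to a multiple of `1 / (P + Q cos x)`. -/
theorem hasDerivAt_sin_div_add_mul_cos {P Q x : ℝ} (hX : P + Q * cos x ≠ 0) :
    HasDerivAt (fun x => Q * sin x / (P + Q * cos x))
      (P / (P + Q * cos x) - (P ^ 2 - Q ^ 2) / (P + Q * cos x) ^ 2) x := by
  refine (((hasDerivAt_sin x).const_mul Q).div
    (((hasDerivAt_cos x).const_mul Q).const_add P) hX).congr_deriv ?_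
  field_simp
  linear_combination Q ^ 2 * sin_sq_add_cos_sq x

theorem integral_sq_one_add_div_add_mul_cos {P Q s : ℝ} (b : ℝ) (hs : 0 < s) (hP : |Q| < P)
    (hsq : s ^ 2 = P ^ 2 - Q ^ 2) :
    ∫ x in (0 : ℝ)..(2 * π), (1 + b / (P + Q * cos x)) ^ 2
      = 2 * π * (1 + (2 * b * s ^ 2 + b ^ 2 * P) / s ^ 3) := by
  have hX : ∀ x, P + Q * cos x ≠ 0 := fun x => by
    have hQ : |Q * cos x| ≤ |Q| := by
      rw [abs_mul]
      exact mul_le_of_le_one_right (abs_nonneg Q) (abs_cos_le_one x)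
    linarith [neg_abs_le (Q * cos x)]
  rw [intervalIntegral.integral_eq_sub_of_hasDerivAt
    (f := fun x => x + (2 * b + b ^ 2 * P / s ^ 2)
        * ((x - 2 * arctan (Q * sin x / (P + s + Q * cos x))) / s)
      - b ^ 2 / s ^ 2 * (Q * sin x / (P + Q * cos x)))]
  · simp only [sin_two_pi, sin_zero, mul_zero, zero_div, arctan_zero]
    field_simp
    ring
  · intro x _
    refine (((hasDerivAt_id x).add
      ((hasDerivAt_integral_inv_add_mul_cos hs hP hsq x).const_mul _)).sub
      ((hasDerivAt_sin_div_add_mul_cos (hX x)).const_mul _)).congr_deriv ?_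
    have := hX x
    rw [← hsq]
    field_simp
    ring
  · refine Continuous.intervalIntegrable ?_ _ _
    fun_prop (disch := exact hX)

/-- The squared-integrand closed-form identity (Eq. (21)) arising for Nakagami-2 fading:
`(1/(2π)) ∫₀^{2π} (1 + b/((a+cosψ)²+(sinψ)² − b))² dψ
  = 1 + (2b(1−a²)² − 3b²(1+a²) + b³)/D^{3/2}`. -/
theorem nakagami2_square_integral_closed_form
    (a b D : ℝ) (ha : 0 ≤ a) (hb : 0 < b) (hab : b < (a - 1) ^ 2)
    (hD : D = a ^ 4 + (b - 1) ^ 2 - 2 * a ^ 2 * (1 + b)) :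
    (1 / (2 * π)) *
        (∫ ψ in (0 : ℝ)..(2 * π),
          (1 + b / ((a + Real.cos ψ) ^ 2 + (Real.sin ψ) ^ 2 - b)) ^ 2)
      = 1 + (2 * b * (1 - a ^ 2) ^ 2 - 3 * b ^ 2 * (1 + a ^ 2) + b ^ 3)
          / D ^ ((3 : ℝ) / 2) := by
  have hP : |2 * a| < a ^ 2 + 1 - b := by
    rw [abs_of_nonneg (by positivity)]
    linarith
  have hDPQ : D = (a ^ 2 + 1 - b) ^ 2 - (2 * a) ^ 2 := by
    rw [hD]
    ring
  have hDpos : 0 < D := by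
    rw [hDPQ, sub_pos]
    exact sq_lt_sq.mpr (hP.trans_le (le_abs_self _))
  have hsq : √D ^ 2 = D := sq_sqrt hDpos.le
  have hpow : D ^ ((3 : ℝ) / 2) = √D ^ 3 := by
    rw [sqrt_eq_rpow, ← rpow_natCast, ← rpow_mul hDpos.le]
    norm_num
  have hden : ∀ ψ : ℝ, (a + cos ψ) ^ 2 + sin ψ ^ 2 - b = a ^ 2 + 1 - b + 2 * a * cos ψ :=
    fun ψ => by linear_combination sin_sq_add_cos_sq ψ
  simp only [hden]
  rw [integral_sq_one_add_div_add_mul_cos b (sqrt_pos.mpr hDpos) hP (hsq.trans hDPQ), hpow, hsq,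
    one_div, inv_mul_cancel_left₀ two_pi_pos.ne', hD]
  ring
end

section
/- Let a ≥ 0 and b > 0 be real numbers with b/2 < (a − 1)² (in particular a ≠ 1), set D(a, b/2) = a⁴ + (b/2 − 1)² − 2a²(1 + b/2), and let N be a natural number. Then ( (1/(2π)) ∫₀^{2π} ( ((a + cos ψ)² + (sin ψ)²) / ((a + cos ψ)² + (sin ψ)² − b/2) )² dψ )^N = ( 1 + ( b(1 − a²)² − 3(b/2)²(1 + a²) + (b/2)³ ) / D(a, b/2)^{3/2} )^N. -/
open Real

section CosineDenominator

variable {p q : ℝ}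

lemma add_mul_cos_pos_s6 (h : |q| < p) (x : ℝ) : 0 < p + q * cos x := by
  have h₁ : |q * cos x| ≤ |q| := by
    rw [abs_mul]
    exact mul_le_of_le_one_right (abs_nonneg q) (abs_cos_le_one x)
  linarith [neg_abs_le (q * cos x)]

lemma sq_sub_sq_pos_of_abs_lt (h : |q| < p) : 0 < p ^ 2 - q ^ 2 :=
  sub_pos.2 (sq_lt_sq' (abs_lt.1 h).1 (abs_lt.1 h).2)

/-- A primitive of `1 / (p + q cos x)` that is smooth on the whole real line. -/
lemma hasDerivAt_primitive_inv_add_mul_cos (h : |q| < p) (x : ℝ) :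
    HasDerivAt (fun y ↦ (y - 2 * arctan (q * sin y / (p + √(p ^ 2 - q ^ 2) + q * cos y)))
      / √(p ^ 2 - q ^ 2)) (p + q * cos x)⁻¹ x := by
  have hD := sq_sub_sq_pos_of_abs_lt h
  have hs : 0 < √(p ^ 2 - q ^ 2) := sqrt_pos.2 hD
  have hs2 : √(p ^ 2 - q ^ 2) ^ 2 = p ^ 2 - q ^ 2 := sq_sqrt hD.le
  set s := √(p ^ 2 - q ^ 2)
  have hw := add_mul_cos_pos_s6 h x
  have hE : 0 < p + s + q * cos x := by linarith
  have hu := ((hasDerivAt_sin x).const_mul q).div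
    (((hasDerivAt_cos x).const_mul q).const_add (p + s)) hE.ne'
  refine (((hasDerivAt_id x).sub (hu.arctan.const_mul 2)).div_const s).congr_deriv ?_
  have hm : 0 < p + s := by linarith [abs_nonneg q]
  have hsum : 1 + (q * sin x / (p + s + q * cos x)) ^ 2
      = 2 * (p + s) * (p + q * cos x) / (p + s + q * cos x) ^ 2 := by
    field_simp
    linear_combination q ^ 2 * sin_sq_add_cos_sq x + hs2
  simp only [Pi.div_apply]
  rw [hsum]
  field_simp
  linear_combination (-q ^ 2) * sin_sq_add_cos_sq x - hs2

/-- The derivative that reduces the integral of `1 / (p + q cos x) ^ 2` to that of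
`1 / (p + q cos x)`. -/
lemma hasDerivAt_mul_sin_div_add_mul_cos (h : |q| < p) (x : ℝ) :
    HasDerivAt (fun y ↦ q * sin y / (p + q * cos y))
      (p * (p + q * cos x)⁻¹ - (p ^ 2 - q ^ 2) * ((p + q * cos x) ^ 2)⁻¹) x := by
  have hw := add_mul_cos_pos_s6 h x
  refine (((hasDerivAt_sin x).const_mul q).div
    (((hasDerivAt_cos x).const_mul q).const_add p) hw.ne').congr_deriv ?_
  field_simp
  linear_combination q ^ 2 * sin_sq_add_cos_sq x

lemma continuous_inv_add_mul_cos (h : |q| < p) : Continuous fun x ↦ (p + q * cos x)⁻¹ :=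
  Continuous.inv₀ (by fun_prop) fun x ↦ (add_mul_cos_pos_s6 h x).ne'

theorem integral_inv_add_mul_cos (h : |q| < p) :
    ∫ x in (0 : ℝ)..(2 * π), (p + q * cos x)⁻¹ = 2 * π / √(p ^ 2 - q ^ 2) := by
  rw [intervalIntegral.integral_eq_sub_of_hasDerivAt
    (fun x _ ↦ hasDerivAt_primitive_inv_add_mul_cos h x)
    ((continuous_inv_add_mul_cos h).intervalIntegrable _ _)]
  simp

lemma continuous_inv_add_mul_cos_sq (h : |q| < p) :
    Continuous fun x ↦ ((p + q * cos x) ^ 2)⁻¹ :=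
  Continuous.inv₀ (by fun_prop) fun x ↦ (pow_pos (add_mul_cos_pos_s6 h x) 2).ne'

theorem integral_inv_add_mul_cos_sq (h : |q| < p) :
    ∫ x in (0 : ℝ)..(2 * π), ((p + q * cos x) ^ 2)⁻¹
      = 2 * π * p / √(p ^ 2 - q ^ 2) ^ 3 := by
  have hD := sq_sub_sq_pos_of_abs_lt h
  have hs : 0 < √(p ^ 2 - q ^ 2) := sqrt_pos.2 hD
  have hi₁ := ((continuous_inv_add_mul_cos h).const_mul p).intervalIntegrable
    (μ := MeasureTheory.volume) 0 (2 * π)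
  have hi₂ := ((continuous_inv_add_mul_cos_sq h).const_mul (p ^ 2 - q ^ 2)).intervalIntegrable
    (μ := MeasureTheory.volume) 0 (2 * π)
  have key := intervalIntegral.integral_eq_sub_of_hasDerivAt
    (fun x _ ↦ hasDerivAt_mul_sin_div_add_mul_cos h x) (hi₁.sub hi₂)
  rw [intervalIntegral.integral_sub hi₁ hi₂, intervalIntegral.integral_const_mul,
    intervalIntegral.integral_const_mul, integral_inv_add_mul_cos h] at key
  simp only [sin_two_pi, sin_zero, mul_zero, zero_div, sub_self] at key
  rw [pow_succ, sq_sqrt hD.le]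
  field_simp at key ⊢
  linarith

end CosineDenominator

/-- Closed form (Eq. (22)) for the Laplace transform of the aggregated reflected signal power
for `N` uniformly placed RISs with Nakagami-2 fading:
`((1/(2π)) ∫₀^{2π} (A(ψ)/(A(ψ) − b/2))² dψ)^N
  = (1 + (b(1−a²)² − 3(b/2)²(1+a²) + (b/2)³)/D(a,b/2)^{3/2})^N`,
where `A(ψ) = (a+cosψ)²+(sinψ)²` and `D(a,b/2) = a⁴+(b/2−1)²−2a²(1+b/2)`. -/
theorem bpp_nakagami2_laplace_closed_form
    (a b D : ℝ) (ha : 0 ≤ a) (hb : 0 < b) (hab : b / 2 < (a - 1) ^ 2)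
    (hD : D = a ^ 4 + (b / 2 - 1) ^ 2 - 2 * a ^ 2 * (1 + b / 2)) (N : ℕ) :
    ((1 / (2 * π)) *
        ∫ ψ in (0 : ℝ)..(2 * π),
          (((a + Real.cos ψ) ^ 2 + (Real.sin ψ) ^ 2) /
            ((a + Real.cos ψ) ^ 2 + (Real.sin ψ) ^ 2 - b / 2)) ^ 2) ^ N
      = (1 + (b * (1 - a ^ 2) ^ 2 - 3 * (b / 2) ^ 2 * (1 + a ^ 2) + (b / 2) ^ 3)
            / D ^ ((3 : ℝ) / 2)) ^ N := by
  have hq : |2 * a| < 1 + a ^ 2 - b / 2 := by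
    rw [abs_of_nonneg (by positivity)]
    linarith
  have hD' : D = (1 + a ^ 2 - b / 2) ^ 2 - (2 * a) ^ 2 := by rw [hD]; ring
  have hDpos : 0 < D := hD' ▸ sq_sub_sq_pos_of_abs_lt hq
  have hpow : D ^ ((3 : ℝ) / 2) = √D ^ 3 := by
    rw [sqrt_eq_rpow, ← rpow_natCast, ← rpow_mul hDpos.le]
    norm_num
  have hint : ∀ x : ℝ, (((a + cos x) ^ 2 + sin x ^ 2) / ((a + cos x) ^ 2 + sin x ^ 2 - b / 2)) ^ 2
      = 1 + b * (1 + a ^ 2 - b / 2 + 2 * a * cos x)⁻¹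
        + (b / 2) ^ 2 * ((1 + a ^ 2 - b / 2 + 2 * a * cos x) ^ 2)⁻¹ := by
    intro x
    have hw := add_mul_cos_pos_s6 hq x
    have hA : (a + cos x) ^ 2 + sin x ^ 2 = (1 + a ^ 2 - b / 2 + 2 * a * cos x) + b / 2 := by
      linear_combination sin_sq_add_cos_sq x
    rw [hA, add_sub_cancel_right]
    generalize 1 + a ^ 2 - b / 2 + 2 * a * cos x = w at hw
    field_simp
    ring
  have hi₁ := ((continuous_inv_add_mul_cos hq).const_mul b).intervalIntegrable
    (μ := MeasureTheory.volume) 0 (2 * π)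
  have hi₂ := ((continuous_inv_add_mul_cos_sq hq).const_mul ((b / 2) ^ 2)).intervalIntegrable
    (μ := MeasureTheory.volume) 0 (2 * π)
  have hi₀ : IntervalIntegrable (fun _ : ℝ ↦ (1 : ℝ)) MeasureTheory.volume 0 (2 * π) :=
    intervalIntegrable_const
  congr 1
  simp_rw [hint]
  rw [intervalIntegral.integral_add (hi₀.add hi₁) hi₂, intervalIntegral.integral_add hi₀ hi₁,
    intervalIntegral.integral_const_mul, intervalIntegral.integral_const_mul,
    integral_inv_add_mul_cos hq, integral_inv_add_mul_cos_sq hq, intervalIntegral.integral_const,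
    ← hD', hpow, smul_eq_mul]
  have hs : 0 < √D := sqrt_pos.2 hDpos
  have hs2 : √D ^ 2 = (1 + a ^ 2 - b / 2) ^ 2 - (2 * a) ^ 2 := by rw [sq_sqrt hDpos.le, hD']
  have hπ := pi_pos
  generalize √D = s at hs hs2
  field_simp
  linear_combination 8 * b * π * hs2
end
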